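/- Consider the composition of two message-passing GNN layers on a finite directed graph G = (𝒱, ℰ) (each layer with its own arbitrary edge update, multiset aggregation, and vertex update functions, and with global attributes ignored). Then the output at a vertex k depends only on the two-ring neighborhood of k: if two input attribute assignments (v, e) and (ṽ, ẽ) agree on the vertex k, on every in-neighbor of k, on every in-neighbor of an in-neighbor of k, on every edge terminating at k, and on every edge terminating at an in-neighbor of k, then the vertex attribute at k produced by applying the two layers in sequence is the same for both assignments. -/

import Mathlib

/-- The edge outputs of a message-passing GNN layer:
`e'_{ij} = φ_e(e_{ij}, v_i, v_j)`. -/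
def gnnLayerEdge {ι E V E' : Type*}
    (φe : E → V → V → E') (v : ι → V) (e : ι × ι → E) : ι × ι → E' :=
  fun p => φe (e p) (v p.1) (v p.2)

/-- The vertex outputs of a message-passing GNN layer (global attributes
ignored): `v'_k = φ_v(v_k, ρ({e'_{ik} : (i,k) ∈ ℰ}))` where the multiset
aggregation `ρ` collects the updated attributes of all edges terminating
at `k`. -/
def gnnLayerVertex {ι E V E' M V' : Type*} [DecidableEq ι]
    (ℰ : Finset (ι × ι))
    (φe : E → V → V → E') (ρ : Multiset E' → M) (φv : V → M → V')
    (v : ι → V) (e : ι × ι → E) : ι → V' :=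
  fun k => φv (v k)
    (ρ ((ℰ.filter (fun p => p.2 = k)).val.map (fun p => gnnLayerEdge φe v e p)))

theorem gnnLayerEdge_congr {ι E V E' : Type*} (φe : E → V → V → E') {v w : ι → V}
    {e f : ι × ι → E} {p : ι × ι} (he : e p = f p) (h₁ : v p.1 = w p.1) (h₂ : v p.2 = w p.2) :
    gnnLayerEdge φe v e p = gnnLayerEdge φe w f p := by
  simp only [gnnLayerEdge, he, h₁, h₂]

/-- The vertex output of one layer depends only on the one-ring neighborhood. -/
theorem gnnLayerVertex_congr {ι E V E' M V' : Type*} [DecidableEq ι] {ℰ : Finset (ι × ι)}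
    (φe : E → V → V → E') (ρ : Multiset E' → M) (φv : V → M → V')
    {v w : ι → V} {e f : ι × ι → E} {k : ι} (hk : v k = w k)
    (hv : ∀ i, (i, k) ∈ ℰ → v i = w i) (he : ∀ i, (i, k) ∈ ℰ → e (i, k) = f (i, k)) :
    gnnLayerVertex ℰ φe ρ φv v e k = gnnLayerVertex ℰ φe ρ φv w f k := by
  unfold gnnLayerVertex
  rw [hk]
  congr 2
  refine Multiset.map_congr rfl fun p hp => ?_
  obtain ⟨i, j⟩ := p
  obtain ⟨hmem, rfl⟩ := Finset.mem_filter.mp (Finset.mem_val.mp hp)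
  exact gnnLayerEdge_congr φe (he i hmem) (hv i hmem) hk

/-- The composition of two message-passing GNN layers on a finite directed
graph depends, at a vertex `k`, only on the two-ring neighborhood of `k`:
if two input attribute assignments agree at `k`, at every in-neighbor of `k`,
at every in-neighbor of an in-neighbor of `k`, on every edge terminating at
`k`, and on every edge terminating at an in-neighbor of `k`, then the vertex
attribute at `k` produced by applying the two layers in sequence is the same
for both assignments. -/
theorem gnn_two_layers_two_ring_locality
    {ι E V E1 M1 V1 E2 M2 V2 : Type*} [DecidableEq ι]
    (ℰ : Finset (ι × ι))
    (φe1 : E → V → V → E1) (ρ1 : Multiset E1 → M1) (φv1 : V → M1 → V1)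
    (φe2 : E1 → V1 → V1 → E2) (ρ2 : Multiset E2 → M2) (φv2 : V1 → M2 → V2)
    (v w : ι → V) (e f : ι × ι → E) (k : ι)
    (hvk : v k = w k)
    (hv1 : ∀ i, (i, k) ∈ ℰ → v i = w i)
    (hv2 : ∀ i j, (i, k) ∈ ℰ → (j, i) ∈ ℰ → v j = w j)
    (he1 : ∀ i, (i, k) ∈ ℰ → e (i, k) = f (i, k))
    (he2 : ∀ i j, (i, k) ∈ ℰ → (j, i) ∈ ℰ → e (j, i) = f (j, i)) :
    gnnLayerVertex ℰ φe2 ρ2 φv2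
        (gnnLayerVertex ℰ φe1 ρ1 φv1 v e) (gnnLayerEdge φe1 v e) k =
      gnnLayerVertex ℰ φe2 ρ2 φv2
        (gnnLayerVertex ℰ φe1 ρ1 φv1 w f) (gnnLayerEdge φe1 w f) k := by
  refine gnnLayerVertex_congr φe2 ρ2 φv2 ?_ (fun i hi => ?_) (fun i hi => ?_)
  · exact gnnLayerVertex_congr φe1 ρ1 φv1 hvk hv1 he1
  · exact gnnLayerVertex_congr φe1 ρ1 φv1 (hv1 i hi) (fun j => hv2 i j hi) (fun j => he2 i j hi)
  · exact gnnLayerEdge_congr φe1 (he1 i hi) (hv1 i hi) hvk
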